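/- Let n ≥ 1, let X ⊆ ℝⁿ be nonempty, let ε ∈ (0,1), and let UB, LB be real-valued functions on the nonempty subsets of X such that for every c > 0 there exists δ > 0 with UB(Q) - LB(Q) < c whenever Q ⊆ X is nonempty with diameter d(Q) < δ. Let (Q_r)_{r∈ℕ} be a sequence of nonempty subsets of X with d(Q_r) → 0, and let m : ℕ → ℝ be a sequence with LB(Q_r) ≤ m r for all r and such that there exist μ₀ > 0 and r₀ with m r ≥ μ₀ for all r > r₀. Then there exists r with UB(Q_r) < m r / (1-ε). -/

import Mathlib

/-- Analytic core of Theorem 2: with continuous bounds `UB, LB` (Definition 1)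
on the nonempty subsets of `X ⊆ ℝⁿ`, a sequence of nonempty subsets `Q_r ⊆ X`
with diameters tending to `0`, and a running-maximum sequence `m` with
`LB(Q_r) ≤ m r` that eventually exceeds some `μ₀ > 0`, the pruning condition
`UB(Q_r) < m r/(1-ε)` holds for some `r`. -/
theorem stmt_8 (n : ℕ) (hn : 1 ≤ n)
    (X : Set (EuclideanSpace ℝ (Fin n))) (hX : X.Nonempty)
    (ε : ℝ) (hε0 : 0 < ε) (hε1 : ε < 1)
    (UB LB : Set (EuclideanSpace ℝ (Fin n)) → ℝ)
    (hcont : ∀ c > 0, ∃ δ > 0, ∀ Q : Set (EuclideanSpace ℝ (Fin n)),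
      Q.Nonempty → Q ⊆ X → Metric.diam Q < δ → UB Q - LB Q < c)
    (Q : ℕ → Set (EuclideanSpace ℝ (Fin n)))
    (hQne : ∀ r, (Q r).Nonempty) (hQsub : ∀ r, Q r ⊆ X)
    (hd : Filter.Tendsto (fun r => Metric.diam (Q r)) Filter.atTop (nhds 0))
    (m : ℕ → ℝ) (hm : ∀ r, LB (Q r) ≤ m r)
    (hμ : ∃ μ₀ > 0, ∃ r₀ : ℕ, ∀ r > r₀, μ₀ ≤ m r) :
    ∃ r, UB (Q r) < m r / (1 - ε) := by
  obtain ⟨μ₀, hμ₀, r₀, hr₀⟩ := hμ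
  obtain ⟨δ, hδ, hgap⟩ := hcont (ε * μ₀) (mul_pos hε0 hμ₀)
  obtain ⟨r, hdiam, hr⟩ :=
    ((hd.eventually (gt_mem_nhds hδ)).and (Filter.eventually_gt_atTop r₀)).exists
  have hε : 0 < 1 - ε := sub_pos.2 hε1
  have hmr : μ₀ ≤ m r := hr₀ r hr
  have hUB : UB (Q r) < (1 + ε) * m r := by
    linarith [hgap (Q r) (hQne r) (hQsub r) hdiam, hm r, mul_le_mul_of_nonneg_left hmr hε0.le]
  refine ⟨r, (lt_div_iff₀ hε).2 ?_⟩
  calc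
    UB (Q r) * (1 - ε) < (1 + ε) * m r * (1 - ε) := mul_lt_mul_of_pos_right hUB hε
    _ = m r - ε ^ 2 * m r := by ring
    _ ≤ m r := sub_le_self _ (mul_nonneg (sq_nonneg ε) (hμ₀.le.trans hmr))
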